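/- Let l ≥ 1 and n ≥ 4l+2 be integers. Suppose (u_0, …, u_{2l+1}) and (u'_0, …, u'_{2l+1}) are inscribed equilateral (2l+1)-pointed stars in P_n with side lengths r, r' ∈ (0, r_n], and suppose both stars contain a vertex of P_n among their points (i.e. some u_i and some u'_j is a vertex of P_n). Then r = r'. Likewise, if both stars contain a midpoint of an edge of P_n among their points, then r = r'. -/

import Mathlib

noncomputable section

/-- The primitive `n`-th root of unity `ω = exp(2πi/n)`. -/
def nroot (n : ℕ) : ℂ := Complex.exp (2 * Real.pi * Complex.I / n)

/-- The boundary of the regular `n`-gon inscribed in the unit circle, as a subset of `ℂ`: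
the union of the closed segments from `ω^j` to `ω^(j+1)` for `j = 0, …, n-1`. -/
def polygon (n : ℕ) : Set ℂ :=
  ⋃ j ∈ Finset.range n, segment ℝ ((nroot n) ^ j) ((nroot n) ^ (j + 1))

/-- The critical scale `r_n`: `2 cos(π/n)` for even `n`,
and `1 + cos(2π/n)/cos(π/n)` for odd `n`. -/
def rpoly (n : ℕ) : ℝ :=
  if Even n then 2 * Real.cos (Real.pi / n)
  else 1 + Real.cos (2 * Real.pi / n) / Real.cos (Real.pi / n)

/-- Arc-length parametrization of the polygon `P_n` by the parameter `t` (normalized so that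
`t ∈ [0,1)` traverses the polygon once counterclockwise, with vertices at `t = j/n`). -/
def polyParam (n : ℕ) (t : ℝ) : ℂ :=
  ((1 - Int.fract (n * t) : ℝ) : ℂ) * (nroot n) ^ (⌊(n : ℝ) * t⌋) +
    ((Int.fract (n * t) : ℝ) : ℂ) * (nroot n) ^ (⌊(n : ℝ) * t⌋ + 1)

/-- The parameter value in `[0,1)` of a point `x ∈ P_n`. -/
def polyArg (n : ℕ) (x : ℂ) : ℝ :=
  sInf {t : ℝ | t ∈ Set.Ico (0 : ℝ) 1 ∧ polyParam n t = x}

/-- The normalized counterclockwise arc distance from `x` to `y` along `P_n`: the length of the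
counterclockwise path along `P_n` from `x` to `y` divided by the total perimeter of `P_n`. -/
def polyDist (n : ℕ) (x y : ℂ) : ℝ := Int.fract (polyArg n y - polyArg n x)

/-- `z` is strictly counterclockwise-between `x` and `y` on `P_n`. -/
def SCCWBtw (n : ℕ) (x z y : ℂ) : Prop :=
  0 < polyDist n x z ∧ polyDist n x z < polyDist n x y

/-- An inscribed equilateral `(2l+1)`-pointed star of side length `r` based at `p ∈ P_n`:
a tuple `(u 0, …, u (2l+1))` of points of `P_n` with `u 0 = u (2l+1) = p`, where consecutive
points are at Euclidean distance `r`, every point of `P_n` strictly counterclockwise-between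
`u i` and `u (i+1)` is at distance `< r` from `u i`, and the total winding number is `l`. -/
def IsStar (n l : ℕ) (r : ℝ) (p : ℂ) (u : ℕ → ℂ) : Prop :=
  u 0 = p ∧ u (2 * l + 1) = p ∧
  (∀ i ≤ 2 * l + 1, u i ∈ polygon n) ∧
  (∀ i ≤ 2 * l, dist (u i) (u (i + 1)) = r) ∧
  (∀ i ≤ 2 * l, ∀ z ∈ polygon n, SCCWBtw n (u i) z (u (i + 1)) → dist (u i) z < r) ∧
  (∑ i ∈ Finset.range (2 * l + 1), polyDist n (u i) (u (i + 1))) = (l : ℝ)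

/-- `x` is a vertex of `P_n`. -/
def IsVertex (n : ℕ) (x : ℂ) : Prop := ∃ j < n, x = (nroot n) ^ j

/-- `x` is the midpoint of an edge of `P_n`. -/
def IsMidpoint (n : ℕ) (x : ℂ) : Prop :=
  ∃ j < n, x = ((nroot n) ^ j + (nroot n) ^ (j + 1)) / 2

end

/-- The primitive `2n`-th root of unity `exp(πi/n)`. -/
noncomputable def halfRoot (n : ℕ) : ℂ := Complex.exp ((Real.pi / n : ℝ) * Complex.I)

/-- Parametrization of the `n`-gon in which every edge has parameter length one. -/
noncomputable def edgeParam (n : ℕ) (x : ℝ) : ℂ :=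
  ((1 - Int.fract x : ℝ) : ℂ) * halfRoot n ^ (2 * ⌊x⌋) +
    ((Int.fract x : ℝ) : ℂ) * halfRoot n ^ (2 * ⌊x⌋ + 2)

lemma halfRoot_ne_zero (n : ℕ) : halfRoot n ≠ 0 := Complex.exp_ne_zero _

lemma norm_halfRoot_zpow (n : ℕ) (k : ℤ) : ‖halfRoot n ^ k‖ = 1 := by
  rw [norm_zpow, halfRoot, Complex.norm_exp_ofReal_mul_I, one_zpow]

lemma halfRoot_zpow (n : ℕ) (k : ℤ) :
    halfRoot n ^ k =
      (Real.cos (k * (Real.pi / n)) : ℂ) + (Real.sin (k * (Real.pi / n)) : ℂ) * Complex.I := by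
  rw [halfRoot, ← Complex.exp_int_mul, Complex.ofReal_cos, Complex.ofReal_sin,
    ← Complex.exp_mul_I]
  congr 1
  push_cast
  ring

lemma halfRoot_eq (n : ℕ) :
    halfRoot n = (Real.cos (Real.pi / n) : ℂ) + (Real.sin (Real.pi / n) : ℂ) * Complex.I := by
  simpa using halfRoot_zpow n 1

lemma nroot_zpow (n : ℕ) (k : ℤ) : nroot n ^ k = halfRoot n ^ (2 * k) := by
  rw [zpow_mul, nroot, halfRoot]
  congr 1
  rw [← Complex.exp_int_mul]
  congr 1
  push_cast
  ring

lemma halfRoot_zpow_self {n : ℕ} (hn : n ≠ 0) : halfRoot n ^ (n : ℤ) = -1 := by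
  rw [halfRoot_zpow]
  push_cast
  rw [show ((n : ℂ) * (Real.pi / n)) = (Real.pi : ℂ) by
    have : (n : ℂ) ≠ 0 := by exact_mod_cast hn
    field_simp]
  simp

lemma polyParam_eq (n : ℕ) (t : ℝ) : polyParam n t = edgeParam n (n * t) := by
  rw [polyParam, edgeParam, nroot_zpow, nroot_zpow, mul_add, mul_one]

lemma edgeParam_add_int (n : ℕ) (x : ℝ) (k : ℤ) :
    edgeParam n (x + k) = halfRoot n ^ (2 * k) * edgeParam n x := by
  have h := halfRoot_ne_zero n
  rw [edgeParam, edgeParam, Int.fract_add_intCast, Int.floor_add_intCast, mul_add, add_right_comm,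
    zpow_add₀ h, zpow_add₀ h (2 * ⌊x⌋ + 2)]
  ring

lemma dist_edgeParam_add_int (n : ℕ) (x y : ℝ) (k : ℤ) :
    dist (edgeParam n (x + k)) (edgeParam n (y + k)) = dist (edgeParam n x) (edgeParam n y) := by
  rw [edgeParam_add_int, edgeParam_add_int, dist_eq_norm, ← mul_sub, norm_mul,
    norm_halfRoot_zpow, one_mul, dist_eq_norm]

lemma edgeParam_add_mul {n : ℕ} (hn : n ≠ 0) (x : ℝ) (k : ℤ) :
    edgeParam n (x + n * k) = edgeParam n x := by
  have h := edgeParam_add_int n x (n * k)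
  push_cast at h
  rw [h, show 2 * ((n : ℤ) * k) = (n : ℤ) * (2 * k) by ring, zpow_mul,
    halfRoot_zpow_self hn, zpow_mul]
  norm_num

lemma edgeParam_of_mem_Icc (n : ℕ) {x : ℝ} {k : ℤ} (h0 : (k : ℝ) ≤ x) (h1 : x ≤ k + 1) :
    edgeParam n x = ((1 - (x - k) : ℝ) : ℂ) * halfRoot n ^ (2 * k) +
      ((x - k : ℝ) : ℂ) * halfRoot n ^ (2 * k + 2) := by
  rcases h1.lt_or_eq with h | h
  · have hk : ⌊x⌋ = k := Int.floor_eq_iff.2 ⟨h0, h⟩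
    rw [edgeParam, Int.fract, hk]
  · have hk : ⌊x⌋ = k + 1 := by rw [h]; simp
    rw [edgeParam, Int.fract, hk, h]
    push_cast
    rw [show 2 * (k + 1) = 2 * k + 2 by ring]
    ring

lemma continuous_edgeParam (n : ℕ) : Continuous (edgeParam n) := by
  rw [continuous_iff_continuousAt]
  intro x
  have key (k : ℤ) : Continuous fun x : ℝ => ((1 - (x - k) : ℝ) : ℂ) * halfRoot n ^ (2 * k) +
      ((x - k : ℝ) : ℂ) * halfRoot n ^ (2 * k + 2) := by fun_prop
  rw [continuousAt_iff_continuous_left_right]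
  constructor
  · have hx1 : x ≤ ((⌈x⌉ - 1 : ℤ) : ℝ) + 1 := by push_cast; linarith [Int.le_ceil x]
    have hx0 : ((⌈x⌉ - 1 : ℤ) : ℝ) < x := by push_cast; linarith [Int.ceil_lt_add_one x]
    refine (key (⌈x⌉ - 1)).continuousWithinAt.congr_of_eventuallyEq ?_
      (edgeParam_of_mem_Icc n hx0.le hx1)
    filter_upwards [self_mem_nhdsWithin, mem_nhdsWithin_of_mem_nhds (lt_mem_nhds hx0)]
      with y hy hy'
    exact edgeParam_of_mem_Icc n (le_of_lt hy') (le_trans hy hx1)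
  · refine (key ⌊x⌋).continuousWithinAt.congr_of_eventuallyEq ?_
      (edgeParam_of_mem_Icc n (Int.floor_le x) (Int.lt_floor_add_one x).le)
    filter_upwards [self_mem_nhdsWithin,
      mem_nhdsWithin_of_mem_nhds (gt_mem_nhds (Int.lt_floor_add_one x))] with y hy hy'
    exact edgeParam_of_mem_Icc n (le_trans (Int.floor_le x) hy) (le_of_lt hy')

/-- The point `edgeParam n x` in coordinates in which the edge number zero is vertical,
with midpoint on the positive real axis. -/
noncomputable def framed (n : ℕ) (x : ℝ) : ℂ := (halfRoot n)⁻¹ * edgeParam n x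

lemma dist_framed (n : ℕ) (x y : ℝ) :
    dist (framed n x) (framed n y) = dist (edgeParam n x) (edgeParam n y) := by
  have h := norm_halfRoot_zpow n (-1)
  rw [zpow_neg_one] at h
  rw [framed, framed, dist_eq_norm, ← mul_sub, norm_mul, h, one_mul, dist_eq_norm]

lemma framed_eq (n : ℕ) (x : ℝ) :
    framed n x = ((1 - Int.fract x : ℝ) : ℂ) * halfRoot n ^ (2 * ⌊x⌋ - 1) +
      ((Int.fract x : ℝ) : ℂ) * halfRoot n ^ (2 * ⌊x⌋ + 1) := by
  have h := halfRoot_ne_zero n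
  rw [framed, edgeParam, zpow_sub₀ h, zpow_add₀ h, zpow_add₀ h, zpow_one, zpow_two]
  field_simp

lemma framed_re (n : ℕ) (x : ℝ) :
    (framed n x).re = (1 - Int.fract x) * Real.cos ((2 * ⌊x⌋ - 1) * (Real.pi / n)) +
      Int.fract x * Real.cos ((2 * ⌊x⌋ + 1) * (Real.pi / n)) := by
  rw [framed_eq, halfRoot_zpow, halfRoot_zpow, Complex.add_re, Complex.re_ofReal_mul,
    Complex.re_ofReal_mul]
  norm_num [-Complex.ofReal_cos, -Complex.ofReal_sin]

lemma framed_im (n : ℕ) (x : ℝ) :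
    (framed n x).im = (1 - Int.fract x) * Real.sin ((2 * ⌊x⌋ - 1) * (Real.pi / n)) +
      Int.fract x * Real.sin ((2 * ⌊x⌋ + 1) * (Real.pi / n)) := by
  rw [framed_eq, halfRoot_zpow, halfRoot_zpow, Complex.add_im, Complex.im_ofReal_mul,
    Complex.im_ofReal_mul]
  norm_num [-Complex.ofReal_cos, -Complex.ofReal_sin]

lemma framed_of_mem_Icc (n : ℕ) {x : ℝ} (h0 : 0 ≤ x) (h1 : x ≤ 1) :
    framed n x = (Real.cos (Real.pi / n) : ℂ) +
      ((2 * x - 1) * Real.sin (Real.pi / n) : ℝ) * Complex.I := by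
  have h := halfRoot_ne_zero n
  have h' : (halfRoot n)⁻¹ =
      (Real.cos (Real.pi / n) : ℂ) - (Real.sin (Real.pi / n) : ℂ) * Complex.I := by
    have := halfRoot_zpow n (-1)
    rw [zpow_neg_one] at this
    rw [this]
    simp [-Complex.ofReal_cos, -Complex.ofReal_sin]
    ring
  have e := edgeParam_of_mem_Icc n (k := 0) (x := x) (by simpa using h0) (by simpa using h1)
  have : framed n x = (1 - x) * (halfRoot n)⁻¹ + x * halfRoot n := by
    rw [framed, e]
    push_cast
    simp only [zpow_zero, zpow_two, sub_zero]
    field_simp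
  rw [this, h', halfRoot_eq]
  push_cast
  ring

lemma dist_edgeParam_sq (n : ℕ) {x : ℝ} (h0 : 0 ≤ x) (h1 : x ≤ 1) (y : ℝ) :
    dist (edgeParam n x) (edgeParam n y) ^ 2 = (Real.cos (Real.pi / n) - (framed n y).re) ^ 2 +
      ((2 * x - 1) * Real.sin (Real.pi / n) - (framed n y).im) ^ 2 := by
  rw [← dist_framed, framed_of_mem_Icc n h0 h1, dist_eq_norm, Complex.sq_norm,
    Complex.normSq_apply]
  simp [-Complex.ofReal_cos, -Complex.ofReal_sin]
  ring

lemma cos_lt_cos_of_lt_of_lt_two_pi_sub {a b : ℝ} (ha : 0 ≤ a) (h1 : a < b)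
    (h2 : b < 2 * Real.pi - a) : Real.cos b < Real.cos a := by
  rcases le_total b Real.pi with h | h
  · exact Real.cos_lt_cos_of_nonneg_of_le_pi ha h h1
  · rw [← Real.cos_two_pi_sub b]
    exact Real.cos_lt_cos_of_nonneg_of_le_pi ha (by linarith) (by linarith)

lemma sin_le_sin_of_le_of_le_pi_sub {a b : ℝ} (ha : 0 ≤ a) (h1 : a ≤ b)
    (h2 : b ≤ Real.pi - a) : Real.sin a ≤ Real.sin b := by
  rcases le_total b (Real.pi / 2) with h | h
  · exact Real.sin_le_sin_of_le_of_le_pi_div_two (by linarith [Real.pi_pos]) h h1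
  · rw [← Real.sin_pi_sub b]
    exact Real.sin_le_sin_of_le_of_le_pi_div_two (by linarith [Real.pi_pos]) (by linarith)
      (by linarith)

lemma sin_pi_div_pos {n : ℕ} (hn : 2 ≤ n) : 0 < Real.sin (Real.pi / n) := by
  have : (2 : ℝ) ≤ n := by exact_mod_cast hn
  refine Real.sin_pos_of_pos_of_lt_pi (by positivity) ?_
  rw [div_lt_iff₀ (by positivity)]
  nlinarith [Real.pi_pos]

lemma edgeParam_inj_unit {n : ℕ} (hn : 3 ≤ n) {x y : ℝ} (hx0 : 0 ≤ x) (hx1 : x < 1)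
    (hxy : x ≤ y) (hy : y < x + n) (h : edgeParam n x = edgeParam n y) : x = y := by
  have hs := sin_pi_div_pos (n := n) (by omega)
  have hnR : (3 : ℝ) ≤ n := by exact_mod_cast hn
  have same (z : ℝ) (hz0 : 0 ≤ z) (hz1 : z ≤ 1) (hz : edgeParam n x = edgeParam n z) : x = z := by
    have hf : framed n x = framed n z := by rw [framed, framed, hz]
    have := congrArg Complex.im hf
    rw [framed_of_mem_Icc n hx0 hx1.le, framed_of_mem_Icc n hz0 hz1] at this
    simp [-Complex.ofReal_cos, -Complex.ofReal_sin] at this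
    rcases this with h | h <;> linarith
  by_cases hy1 : y < 1
  · exact same y (by linarith) hy1.le h
  by_cases hyn : (n : ℝ) ≤ y
  · have := edgeParam_add_mul (n := n) (by omega) y (-1)
    push_cast at this
    have := same (y + n * -1) (by linarith) (by linarith) (by rw [this, h])
    linarith
  push Not at hy1 hyn
  have hre : (framed n y).re = Real.cos (Real.pi / n) := by
    have hf : framed n x = framed n y := by rw [framed, framed, h]
    rw [← hf, framed_of_mem_Icc n hx0 hx1.le]
    simp [-Complex.ofReal_cos, -Complex.ofReal_sin]
  have hm1 : 1 ≤ ⌊y⌋ := Int.le_floor.2 (by simpa using hy1)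
  have hmn : ⌊y⌋ < n := Int.floor_lt.2 (by simpa using hyn)
  have hθ : 0 < Real.pi / n := by positivity
  have hnθ : n * (Real.pi / n) = Real.pi := by field_simp
  have hmnR : (⌊y⌋ : ℝ) + 1 ≤ n := by exact_mod_cast hmn
  have hg0 := Int.fract_nonneg y
  have hg1 := Int.fract_lt_one y
  rw [framed_re] at hre
  set θ := Real.pi / n with hθdef
  rcases hm1.lt_or_eq with hm | hm
  · have hmR : (2 : ℝ) ≤ ⌊y⌋ := by exact_mod_cast hm
    have h1 : Real.cos ((2 * ⌊y⌋ - 1) * θ) < Real.cos θ :=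
      cos_lt_cos_of_lt_of_lt_two_pi_sub hθ.le (by nlinarith) (by nlinarith)
    have h2 : Real.cos ((2 * ⌊y⌋ + 1) * θ) ≤ Real.cos θ := by
      rcases hmnR.lt_or_eq with h | h
      · exact (cos_lt_cos_of_lt_of_lt_two_pi_sub hθ.le (by nlinarith) (by nlinarith)).le
      · rw [show (2 * (⌊y⌋ : ℝ) + 1) * θ = 2 * Real.pi - θ by rw [← hnθ, ← h]; ring,
          Real.cos_two_pi_sub]
    nlinarith
  · have h2 : Real.cos ((2 * ⌊y⌋ + 1) * θ) < Real.cos θ := by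
      rw [← hm]
      push_cast
      exact cos_lt_cos_of_lt_of_lt_two_pi_sub hθ.le (by nlinarith) (by nlinarith)
    rw [show (2 * (⌊y⌋ : ℝ) - 1) * θ = θ by rw [← hm]; push_cast; ring] at hre
    have hg : Int.fract y = 0 := by nlinarith
    have hy1 : y = 1 := by
      rw [← Int.floor_add_fract y, hg, ← hm]; simp
    exact same y (by linarith) hy1.le h

lemma edgeParam_inj {n : ℕ} (hn : 3 ≤ n) {x y : ℝ} (hxy : x ≤ y) (hy : y < x + n)
    (h : edgeParam n x = edgeParam n y) : x = y := by
  have hx := edgeParam_inj_unit hn (x := x + ((-⌊x⌋ : ℤ) : ℝ)) (y := y + ((-⌊x⌋ : ℤ) : ℝ))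
    (by push_cast; linarith [Int.floor_le x]) (by push_cast; linarith [Int.lt_floor_add_one x])
    (by linarith) (by linarith) (by rw [edgeParam_add_int, edgeParam_add_int, h])
  linarith

lemma cos_pi_div_pos {n : ℕ} (hn : 3 ≤ n) : 0 < Real.cos (Real.pi / n) := by
  have : (3 : ℝ) ≤ n := by exact_mod_cast hn
  refine Real.cos_pos_of_mem_Ioo ⟨?_, ?_⟩
  · have : 0 < Real.pi / n := by positivity
    linarith [Real.pi_pos]
  · exact div_lt_div_of_pos_left Real.pi_pos (by norm_num) (by linarith)

lemma rpoly_le_of_odd {n : ℕ} (hn : 3 ≤ n) (hodd : Odd n) {h : ℝ}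
    (hh : h * (2 * Real.cos (Real.pi / n)) ≤ 1) :
    rpoly n ≤ 1 + Real.cos (Real.pi / n) - 2 * h * Real.sin (Real.pi / n) ^ 2 := by
  have hc := cos_pi_div_pos hn
  rw [rpoly, if_neg (Nat.not_even_iff_odd.2 hodd), mul_div_assoc, Real.cos_two_mul, Real.sin_sq]
  set c := Real.cos (Real.pi / n)
  have hc1 : c ^ 2 ≤ 1 := by
    have := Real.cos_le_one (Real.pi / n)
    change c ≤ 1 at this
    nlinarith
  have : (2 * c ^ 2 - 1) / c ≤ c - 2 * h * (1 - c ^ 2) := by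
    rw [div_le_iff₀ hc]
    nlinarith
  linarith

lemma framed_re_of_odd {n q : ℕ} (hq : n = 2 * q + 1) {x : ℝ} (hx : ⌊x⌋ = q) :
    (framed n x).re = -1 + 2 * (1 - Int.fract x) * Real.sin (Real.pi / n) ^ 2 := by
  have h : 2 * (q : ℝ) * (Real.pi / n) = Real.pi - Real.pi / n := by
    rw [hq]; push_cast; field_simp; ring
  rw [framed_re, hx]
  push_cast
  rw [show (2 * (q : ℝ) - 1) * (Real.pi / n) = Real.pi - 2 * (Real.pi / n) by linarith,
    show (2 * (q : ℝ) + 1) * (Real.pi / n) = Real.pi by linarith, Real.cos_pi_sub, Real.cos_pi, Real.cos_two_mul, Real.sin_sq]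
  ring

lemma framed_im_of_odd {n q : ℕ} (hq : n = 2 * q + 1) {x : ℝ} (hx : ⌊x⌋ = q) :
    (framed n x).im =
      (1 - Int.fract x) * (2 * Real.cos (Real.pi / n)) * Real.sin (Real.pi / n) := by
  have h : 2 * (q : ℝ) * (Real.pi / n) = Real.pi - Real.pi / n := by
    rw [hq]; push_cast; field_simp; ring
  rw [framed_im, hx]
  push_cast
  rw [show (2 * (q : ℝ) - 1) * (Real.pi / n) = Real.pi - 2 * (Real.pi / n) by linarith,
    show (2 * (q : ℝ) + 1) * (Real.pi / n) = Real.pi by linarith, Real.sin_pi_sub, Real.sin_pi, Real.sin_two_mul]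
  ring

lemma framed_re_of_odd' {n q : ℕ} (hq : n = 2 * q + 1) {x : ℝ} (hx : ⌊x⌋ = q + 1) :
    (framed n x).re = -1 + 2 * Int.fract x * Real.sin (Real.pi / n) ^ 2 := by
  have h : 2 * (q : ℝ) * (Real.pi / n) = Real.pi - Real.pi / n := by
    rw [hq]; push_cast; field_simp; ring
  rw [framed_re, hx]
  push_cast
  rw [show (2 * ((q : ℝ) + 1) - 1) * (Real.pi / n) = Real.pi by linarith,
    show (2 * ((q : ℝ) + 1) + 1) * (Real.pi / n) = 2 * (Real.pi / n) + Real.pi by linarith,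
    Real.cos_add_pi, Real.cos_pi, Real.cos_two_mul, Real.sin_sq]
  ring

lemma framed_im_of_odd' {n q : ℕ} (hq : n = 2 * q + 1) {x : ℝ} (hx : ⌊x⌋ = q + 1) :
    (framed n x).im =
      -(Int.fract x * (2 * Real.cos (Real.pi / n)) * Real.sin (Real.pi / n)) := by
  have h : 2 * (q : ℝ) * (Real.pi / n) = Real.pi - Real.pi / n := by
    rw [hq]; push_cast; field_simp; ring
  rw [framed_im, hx]
  push_cast
  rw [show (2 * ((q : ℝ) + 1) - 1) * (Real.pi / n) = Real.pi by linarith,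
    show (2 * ((q : ℝ) + 1) + 1) * (Real.pi / n) = 2 * (Real.pi / n) + Real.pi by linarith,
    Real.sin_add_pi, Real.sin_pi, Real.sin_two_mul]
  ring

lemma framed_re_of_even {n q : ℕ} (hn : n ≠ 0) (hq : n = 2 * q) {x : ℝ} (hx : ⌊x⌋ = q) :
    (framed n x).re = -Real.cos (Real.pi / n) := by
  have h : 2 * (q : ℝ) * (Real.pi / n) = Real.pi := by
    have : (q : ℝ) ≠ 0 := by
      intro h
      exact hn (by rw [hq, Nat.cast_eq_zero.1 h])
    rw [hq]; push_cast; field_simp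
  rw [framed_re, hx]
  push_cast
  rw [show (2 * (q : ℝ) - 1) * (Real.pi / n) = Real.pi - Real.pi / n by linarith,
    show (2 * (q : ℝ) + 1) * (Real.pi / n) = Real.pi / n + Real.pi by linarith,
    Real.cos_pi_sub, Real.cos_add_pi]
  ring

lemma cos_sub_framed_re_le_dist (n : ℕ) {x : ℝ} (h0 : 0 ≤ x) (h1 : x ≤ 1) (y : ℝ) :
    Real.cos (Real.pi / n) - (framed n y).re ≤ dist (edgeParam n x) (edgeParam n y) := by
  refine (abs_le.1 (abs_le_of_sq_le_sq ?_ dist_nonneg)).2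
  rw [dist_edgeParam_sq n h0 h1]
  exact le_add_of_nonneg_right (sq_nonneg _)

/-- The ends of a half perimeter are at distance at least `rpoly n`. -/
lemma rpoly_le_dist_half {n : ℕ} (hn : 3 ≤ n) (x : ℝ) :
    rpoly n ≤ dist (edgeParam n x) (edgeParam n (x + n / 2)) := by
  rcases Nat.even_or_odd' n with ⟨q, hq | hq⟩
  · have hqR : (n : ℝ) = 2 * q := by exact_mod_cast hq
    rw [← dist_edgeParam_add_int n _ _ (-⌊x⌋)]
    refine le_trans ?_ (cos_sub_framed_re_le_dist n
      (by push_cast; linarith [Int.floor_le x])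
      (by push_cast; linarith [Int.lt_floor_add_one x]) _)
    rw [framed_re_of_even (by omega) hq, rpoly, if_pos (by rw [hq]; exact even_two_mul q)]
    · linarith
    · rw [Int.floor_eq_iff]
      push_cast
      constructor <;> linarith [Int.floor_le x, Int.lt_floor_add_one x]
  · have hqR : (n : ℝ) = 2 * q + 1 := by exact_mod_cast hq
    have key (x : ℝ) (h0 : 0 ≤ x) (h1 : x < 1 / 2) :
        rpoly n ≤ dist (edgeParam n x) (edgeParam n (x + n / 2)) := by
      have hfl : ⌊x + n / 2⌋ = q := by
        rw [Int.floor_eq_iff]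
        push_cast
        constructor <;> linarith
      refine le_trans ?_ (cos_sub_framed_re_le_dist n h0 (by linarith) _)
      rw [framed_re_of_odd hq hfl]
      have hc := cos_pi_div_pos hn
      have hc1 := Real.cos_le_one (Real.pi / n)
      have hfr : Int.fract (x + n / 2) = x + 1 / 2 := by
        rw [Int.fract, hfl, hqR]; push_cast; ring
      refine (rpoly_le_of_odd hn ⟨q, hq⟩ (h := 1 - Int.fract (x + n / 2)) ?_).trans
        (by linarith)
      rw [hfr]
      nlinarith
    rw [← dist_edgeParam_add_int n _ _ (-⌊x⌋), add_right_comm]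
    set y := x + ((-⌊x⌋ : ℤ) : ℝ) with hy
    have hy0 : 0 ≤ y := by rw [hy]; push_cast; linarith [Int.floor_le x]
    have hy1 : y < 1 := by rw [hy]; push_cast; linarith [Int.lt_floor_add_one x]
    rcases lt_or_ge y (1 / 2) with h | h
    · exact key y hy0 h
    · have := key (y - 1 / 2) (by linarith) (by linarith)
      rw [← dist_edgeParam_add_int n _ _ (q + 1), dist_comm] at this
      convert this using 2
      · rw [← edgeParam_add_mul (by omega) y 1]
        congr 1
        push_cast
        linarith
      · congr 1
        push_cast
        linarith

/-- A point whose orthogonal projection falls inside a far edge has distance at least `rpoly n`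
to the line through that edge. -/
lemma rpoly_le_of_abs_im_lt {n : ℕ} (hn : 3 ≤ n) {y : ℝ} (h1 : 1 ≤ ⌊y⌋) (h2 : 2 * ⌊y⌋ ≤ n + 1)
    (hlo : -Real.sin (Real.pi / n) < (framed n y).im)
    (hhi : (framed n y).im < Real.sin (Real.pi / n)) :
    rpoly n ≤ Real.cos (Real.pi / n) - (framed n y).re := by
  have hs := sin_pi_div_pos (n := n) (by omega)
  have hθ : 0 < Real.pi / n := by positivity
  have hnθ : n * (Real.pi / n) = Real.pi := by field_simp
  by_cases hlow : 2 * ⌊y⌋ + 2 ≤ n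
  · exfalso
    rw [framed_im] at hhi
    set θ := Real.pi / n with hθdef
    have hm1 : (1 : ℝ) ≤ ⌊y⌋ := by exact_mod_cast h1
    have hm2 : 2 * (⌊y⌋ : ℝ) + 2 ≤ n := by exact_mod_cast hlow
    have e1 : Real.sin θ ≤ Real.sin ((2 * ⌊y⌋ - 1) * θ) :=
      sin_le_sin_of_le_of_le_pi_sub hθ.le (by nlinarith) (by nlinarith)
    have e2 : Real.sin θ ≤ Real.sin ((2 * ⌊y⌋ + 1) * θ) :=
      sin_le_sin_of_le_of_le_pi_sub hθ.le (by nlinarith) (by nlinarith)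
    have hg0 := Int.fract_nonneg y
    have hg1 := Int.fract_lt_one y
    nlinarith
  rcases Nat.even_or_odd' n with ⟨q, hq | hq⟩
  · rw [framed_re_of_even (by omega) hq (by omega), rpoly,
      if_pos (by rw [hq]; exact even_two_mul q)]
    linarith
  · rcases (show ⌊y⌋ = q ∨ ⌊y⌋ = q + 1 by omega) with hy | hy
    · rw [framed_im_of_odd hq hy] at hhi
      rw [framed_re_of_odd hq hy]
      refine (rpoly_le_of_odd hn ⟨q, hq⟩ (h := 1 - Int.fract y) ?_).trans (by linarith)
      nlinarith
    · rw [framed_im_of_odd' hq hy] at hlo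
      rw [framed_re_of_odd' hq hy]
      refine (rpoly_le_of_odd hn ⟨q, hq⟩ (h := Int.fract y) ?_).trans (by linarith)
      nlinarith

lemma norm_edgeParam_le_one (n : ℕ) (x : ℝ) : ‖edgeParam n x‖ ≤ 1 := by
  refine (norm_add_le _ _).trans ?_
  rw [norm_mul, norm_mul, norm_halfRoot_zpow, norm_halfRoot_zpow, Complex.norm_real,
    Complex.norm_real, Real.norm_of_nonneg (Int.fract_nonneg x),
    Real.norm_of_nonneg (by linarith [Int.fract_lt_one x])]
  linarith

lemma le_of_sq_sub_le_sq_sub_right {u s Y ε : ℝ} (hs : 0 < s) (hε : 0 < ε)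
    (h : ∀ δ, 0 < δ → δ < ε → (u - Y) ^ 2 ≤ (u + 2 * δ * s - Y) ^ 2) : Y ≤ u := by
  by_contra! hlt
  have hpos : 0 < (Y - u) / (2 * s) := div_pos (by linarith) (by linarith)
  obtain ⟨δ, hδ0, hδ⟩ := exists_between (lt_min hε hpos)
  have h1 := h δ hδ0 (hδ.trans_le (min_le_left _ _))
  have h2 := hδ.trans_le (min_le_right _ _)
  rw [lt_div_iff₀ (by linarith)] at h2
  nlinarith [mul_pos hδ0 hs]

lemma framed_add_one_im_sub (n : ℕ) (y : ℝ) :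
    (framed n (y + 1)).im - (framed n y).im =
      2 * Real.sin (Real.pi / n) * (edgeParam n y).re := by
  have h := edgeParam_add_int n y 1
  have h' := halfRoot_zpow n (-1)
  rw [Int.cast_one] at h
  rw [framed, framed, h, ← mul_assoc, ← zpow_neg_one, ← zpow_add₀ (halfRoot_ne_zero n)]
  norm_num only
  rw [h', zpow_one, halfRoot_eq]
  simp [-Complex.ofReal_cos, -Complex.ofReal_sin]
  ring

lemma rpoly_le_dist_of_isLocalMin_unit {n : ℕ} (hn : 3 ≤ n) {x y : ℝ} (hx0 : 0 ≤ x) (hx1 : x < 1)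
    (hxy : x < y) (hyx : y < x + n / 2)
    (hmin : IsLocalMin (fun z => dist (edgeParam n z) (edgeParam n y)) x) :
    rpoly n ≤ dist (edgeParam n x) (edgeParam n y) := by
  have hs := sin_pi_div_pos (n := n) (by omega)
  have hnR : (3 : ℝ) ≤ n := by exact_mod_cast hn
  obtain ⟨ε, hε, hball⟩ := Metric.eventually_nhds_iff.1 hmin
  have hsq (z : ℝ) (hz : |z - x| < ε) : dist (edgeParam n x) (edgeParam n y) ^ 2 ≤
      dist (edgeParam n z) (edgeParam n y) ^ 2 :=
    pow_le_pow_left₀ dist_nonneg (hball (by rwa [Real.dist_eq])) 2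
  have hright : (framed n y).im ≤ (2 * x - 1) * Real.sin (Real.pi / n) := by
    refine le_of_sq_sub_le_sq_sub_right hs (lt_min hε (sub_pos.2 hx1)) fun δ h0 h1 => ?_
    have hd1 := h1.trans_le (min_le_left _ _)
    have hd2 := h1.trans_le (min_le_right _ _)
    have := hsq (x + δ) (by rwa [add_sub_cancel_left, abs_of_pos h0])
    rw [dist_edgeParam_sq n hx0 hx1.le, dist_edgeParam_sq n (by linarith) (by linarith)] at this
    convert (add_le_add_iff_left _).1 this using 2
    ring
  have hm : 1 ≤ ⌊y⌋ := by
    rw [Int.le_floor, Int.cast_one]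
    by_contra! hy1
    rw [framed_of_mem_Icc n (by linarith) hy1.le] at hright
    simp [-Complex.ofReal_cos, -Complex.ofReal_sin] at hright
    nlinarith
  have hm2 : 2 * ⌊y⌋ ≤ n + 1 := by
    have : (2 * ⌊y⌋ : ℝ) < n + 2 := by linarith [Int.floor_le y]
    have : 2 * ⌊y⌋ < n + 2 := by exact_mod_cast this
    omega
  rcases hx0.eq_or_lt with rfl | hxpos
  · exfalso
    have hleft : -(framed n (y + 1)).im ≤ -Real.sin (Real.pi / n) := by
      refine le_of_sq_sub_le_sq_sub_right hs (lt_min hε one_pos) fun δ h0 h1 => ?_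
      have hd1 := h1.trans_le (min_le_left _ _)
      have hd2 := h1.trans_le (min_le_right _ _)
      have := hsq (-δ) (by rwa [sub_zero, abs_neg, abs_of_pos h0])
      rw [← dist_edgeParam_add_int n 0 y 1, ← dist_edgeParam_add_int n (-δ) y 1, Int.cast_one,
        dist_edgeParam_sq n (by linarith) (by linarith),
        dist_edgeParam_sq n (by linarith) (by linarith)] at this
      convert (add_le_add_iff_left _).1 this using 1 <;> ring
    have hdiff := framed_add_one_im_sub n y
    have hre : 1 ≤ (edgeParam n y).re := by nlinarith
    have hnorm := norm_edgeParam_le_one n y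
    have hone : edgeParam n y = 1 := by
      have h1 : (edgeParam n y).re = ‖edgeParam n y‖ :=
        le_antisymm (Complex.re_le_norm _) (by linarith)
      have h2 := (Complex.re_eq_norm.1 h1)
      apply Complex.ext
      · rw [Complex.one_re]; linarith
      · exact (Complex.nonneg_iff.1 h2).2.symm
    have hzero : edgeParam n 0 = 1 := by simp [edgeParam]
    exact hxy.ne (edgeParam_inj hn hxy.le (by linarith) (hzero.trans hone.symm))
  · have hleft : -(framed n y).im ≤ -((2 * x - 1) * Real.sin (Real.pi / n)) := by
      refine le_of_sq_sub_le_sq_sub_right hs (lt_min hε hxpos) fun δ h0 h1 => ?_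
      have hd1 := h1.trans_le (min_le_left _ _)
      have hd2 := h1.trans_le (min_le_right _ _)
      have := hsq (x - δ) (by rwa [sub_sub_cancel_left, abs_neg, abs_of_pos h0])
      rw [dist_edgeParam_sq n hx0 hx1.le, dist_edgeParam_sq n (by linarith) (by linarith)] at this
      convert (add_le_add_iff_left _).1 this using 1 <;> ring
    exact (rpoly_le_of_abs_im_lt hn hm hm2 (by nlinarith) (by nlinarith)).trans
      (cos_sub_framed_re_le_dist n hx0 hx1.le y)

/-- The distance to a point has no local minimum with value below `rpoly n` on the half perimeter
preceding this point. -/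
lemma rpoly_le_dist_of_isLocalMin {n : ℕ} (hn : 3 ≤ n) {x y : ℝ} (hxy : x < y)
    (hyx : y < x + n / 2)
    (hmin : IsLocalMin (fun z => dist (edgeParam n z) (edgeParam n y)) x) :
    rpoly n ≤ dist (edgeParam n x) (edgeParam n y) := by
  rw [← dist_edgeParam_add_int n x y (-⌊x⌋)]
  refine rpoly_le_dist_of_isLocalMin_unit hn (by push_cast; linarith [Int.floor_le x])
    (by push_cast; linarith [Int.lt_floor_add_one x]) (by linarith) (by linarith) ?_
  have hx : x + ((-⌊x⌋ : ℤ) : ℝ) + ⌊x⌋ = x := by push_cast; ring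
  have hcont : ContinuousAt (fun z : ℝ => z + ⌊x⌋) (x + ((-⌊x⌋ : ℤ) : ℝ)) := by fun_prop
  rw [← hx] at hmin
  convert IsLocalMin.comp_continuous (g := fun z : ℝ => z + ⌊x⌋) hmin hcont using 1
  funext z
  simp only [Function.comp]
  rw [← dist_edgeParam_add_int n z _ ⌊x⌋]
  congr 2
  push_cast
  ring

lemma not_dist_lt_dist_of_nested {n : ℕ} (hn : 3 ≤ n) {r r' s s' t : ℝ} (hss : s ≤ s')
    (hst : s' < t) (hts : t ≤ s + n / 2) (hr : dist (edgeParam n s) (edgeParam n t) ≤ r)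
    (hr' : dist (edgeParam n s') (edgeParam n t) = r') (hrn : r' ≤ rpoly n) : r' ≤ r := by
  by_contra! hlt
  have hcont : Continuous fun z => dist (edgeParam n z) (edgeParam n t) :=
    (continuous_edgeParam n).dist continuous_const
  have hs : s ∈ Set.Icc (t - n / 2) s' := ⟨by linarith, hss⟩
  obtain ⟨x, hx, hmin⟩ := isCompact_Icc.exists_isMinOn ⟨s, hs⟩ hcont.continuousOn
  have hxr : dist (edgeParam n x) (edgeParam n t) ≤ r := (hmin hs).trans hr
  have h1 : t - n / 2 < x := by
    refine lt_of_le_of_ne hx.1 ?_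
    rintro rfl
    have := rpoly_le_dist_half hn (t - n / 2)
    rw [sub_add_cancel] at this
    linarith
  have h2 : x < s' := by
    refine lt_of_le_of_ne hx.2 ?_
    rintro rfl
    linarith
  have := rpoly_le_dist_of_isLocalMin hn (h2.trans hst) (by linarith)
    (hmin.isLocalMin (Icc_mem_nhds h1 h2))
  linarith

/-- `t` is the parameter of the first point after `edgeParam n s` at distance `r` from it. -/
def IsStep (n : ℕ) (r s t : ℝ) : Prop :=
  s ≤ t ∧ t ≤ s + n / 2 ∧ dist (edgeParam n s) (edgeParam n t) = r ∧
    ∀ x, s < x → x < t → dist (edgeParam n s) (edgeParam n x) < r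

lemma IsStep.add_int {n : ℕ} {r s t : ℝ} (h : IsStep n r s t) (k : ℤ) :
    IsStep n r (s + k) (t + k) := by
  obtain ⟨h1, h2, h3, h4⟩ := h
  refine ⟨by linarith, by linarith, by rw [dist_edgeParam_add_int, h3], fun x hx hx' => ?_⟩
  have := h4 (x - k) (by linarith) (by linarith)
  rwa [← dist_edgeParam_add_int n _ _ k, sub_add_cancel] at this

lemma IsStep.lt_of_lt {n : ℕ} (hn : 3 ≤ n) {r r' s s' t t' : ℝ} (h : IsStep n r s t)
    (h' : IsStep n r' s' t') (hr : r < r') (hr' : r' ≤ rpoly n) (hs : s ≤ s') : t < t' := by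
  obtain ⟨-, h2, h3, h4⟩ := h
  obtain ⟨h1', -, h3', -⟩ := h'
  have hr0 : 0 ≤ r := h3 ▸ dist_nonneg
  have hst : s' < t' := by
    refine lt_of_le_of_ne h1' ?_
    rintro rfl
    rw [dist_self] at h3'
    linarith
  by_contra! htt
  refine hr.not_ge (not_dist_lt_dist_of_nested hn hs hst (by linarith) ?_ h3' hr')
  rcases htt.lt_or_eq with h | rfl
  · exact (h4 t' (by linarith) h).le
  · exact h3.le

lemma polyArg_edgeParam {n : ℕ} (hn : 3 ≤ n) (x : ℝ) :
    polyArg n (edgeParam n x) = Int.fract (x / n) := by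
  have hn0 : (0 : ℝ) < n := by positivity
  have hx : edgeParam n (n * Int.fract (x / n)) = edgeParam n x := by
    rw [← edgeParam_add_mul (by omega) (n * Int.fract (x / n)) ⌊x / n⌋, ← mul_add,
      Int.fract_add_floor, mul_div_cancel₀ _ hn0.ne']
  have h0 := Int.fract_nonneg (x / n)
  have h1 := Int.fract_lt_one (x / n)
  have : {t : ℝ | t ∈ Set.Ico (0 : ℝ) 1 ∧ polyParam n t = edgeParam n x} =
      {Int.fract (x / n)} := by
    ext t
    simp only [Set.mem_ofPred_eq, Set.mem_Ico, Set.mem_singleton_iff, polyParam_eq]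
    refine ⟨fun ⟨⟨ht0, ht1⟩, ht⟩ => ?_, ?_⟩
    · rw [← hx] at ht
      refine mul_left_cancel₀ hn0.ne' ?_
      rcases le_total t (Int.fract (x / n)) with h | h
      · exact edgeParam_inj hn (by nlinarith) (by nlinarith) ht
      · exact (edgeParam_inj hn (by nlinarith) (by nlinarith) ht.symm).symm
    · rintro rfl
      exact ⟨⟨h0, h1⟩, hx⟩
  rw [polyArg, this, csInf_singleton]

lemma polyDist_edgeParam {n : ℕ} (hn : 3 ≤ n) (x y : ℝ) :
    polyDist n (edgeParam n x) (edgeParam n y) = Int.fract ((y - x) / n) := by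
  rw [polyDist, polyArg_edgeParam hn, polyArg_edgeParam hn, Int.fract_eq_fract]
  refine ⟨⌊x / n⌋ - ⌊y / n⌋, ?_⟩
  rw [Int.fract, Int.fract]
  push_cast
  ring

lemma polyDist_edgeParam_of_lt {n : ℕ} (hn : 3 ≤ n) {x y : ℝ} (h : x ≤ y) (h' : y < x + n) :
    polyDist n (edgeParam n x) (edgeParam n y) = (y - x) / n := by
  have hn0 : (0 : ℝ) < n := by positivity
  rw [polyDist_edgeParam hn, Int.fract_eq_self]
  exact ⟨div_nonneg (by linarith) hn0.le, by rw [div_lt_one hn0]; linarith⟩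

lemma mem_polygon_iff {n : ℕ} (hn : n ≠ 0) {z : ℂ} : z ∈ polygon n ↔ ∃ x, z = edgeParam n x := by
  have hpow (j : ℕ) : nroot n ^ j = halfRoot n ^ (2 * (j : ℤ)) := by
    rw [← zpow_natCast, nroot_zpow]
  have hpow' (j : ℕ) : nroot n ^ (j + 1) = halfRoot n ^ (2 * (j : ℤ) + 2) := by
    rw [hpow]; push_cast; rw [mul_add, mul_one]
  simp only [polygon, Set.mem_iUnion, Finset.mem_range, exists_prop]
  constructor
  · rintro ⟨j, -, a, b, ha, hb, hab, rfl⟩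
    refine ⟨j + b, ?_⟩
    rw [edgeParam_of_mem_Icc n (k := j) (by push_cast; linarith) (by push_cast; linarith),
      hpow, hpow', ← hab]
    simp
  · rintro ⟨x, rfl⟩
    have hn0 : (0 : ℝ) < n := by positivity
    have hx : edgeParam n (n * Int.fract (x / n)) = edgeParam n x := by
      rw [← edgeParam_add_mul hn (n * Int.fract (x / n)) ⌊x / n⌋, ← mul_add,
        Int.fract_add_floor, mul_div_cancel₀ _ hn0.ne']
    rw [← hx]
    set y := n * Int.fract (x / n) with hy
    have hy0 : 0 ≤ y := mul_nonneg hn0.le (Int.fract_nonneg _)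
    have hyn : y < n := by
      have := Int.fract_lt_one (x / n)
      nlinarith
    refine ⟨⌊y⌋₊, (Nat.floor_lt hy0).2 hyn, 1 - Int.fract y, Int.fract y,
      by linarith [Int.fract_lt_one y], Int.fract_nonneg y, by ring, ?_⟩
    rw [edgeParam, hpow, hpow', Int.natCast_floor_eq_floor hy0]
    simp

lemma sum_range_add_mod {M : Type*} [AddCommGroup M] (g : ℕ → M) (N i : ℕ) :
    ∑ q ∈ Finset.range N, g ((i + q) % N) = ∑ q ∈ Finset.range N, g q := by
  induction i with
  | zero =>
    refine Finset.sum_congr rfl fun q hq => ?_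
    rw [zero_add, Nat.mod_eq_of_lt (Finset.mem_range.1 hq)]
  | succ i ih =>
    rw [← ih]
    have h := Finset.sum_range_succ (fun q => g ((i + q) % N)) N
    rw [Finset.sum_range_succ', Nat.add_mod_right, add_zero] at h
    rw [← add_right_cancel h]
    refine Finset.sum_congr rfl fun q _ => ?_
    rw [add_assoc, add_comm 1 q]

lemma IsStar.exists_lift {n l : ℕ} (hn : 3 ≤ n) {r : ℝ} (hrn : r ≤ rpoly n) {p : ℂ} {u : ℕ → ℂ}
    (h : IsStar n l r p u) {i : ℕ} (hi : i ≤ 2 * l) {a : ℝ} (ha : u i = edgeParam n a) :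
    ∃ S : ℕ → ℝ, S 0 = a ∧ S (2 * l + 1) = a + n * l ∧
      ∀ m, IsStep n r (S m) (S (m + 1)) := by
  obtain ⟨hp0, hp1, hmem, hdist, hbtw, hsum⟩ := h
  have hn0 : (0 : ℝ) < n := by positivity
  set N := 2 * l + 1 with hN
  have hmod (m : ℕ) : (i + m) % N ≤ 2 * l := Nat.le_of_lt_succ (Nat.mod_lt _ (by omega))
  have hnext (m : ℕ) : u ((i + (m + 1)) % N) = u ((i + m) % N + 1) := by
    rw [← add_assoc, ← Nat.mod_add_mod]
    rcases (hmod m).lt_or_eq with hlt | heq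
    · rw [Nat.mod_eq_of_lt (by omega)]
    · rw [heq, ← hN, Nat.mod_self, hp0, hp1]
  set S : ℕ → ℝ := fun m => a + n * ∑ q ∈ Finset.range m,
    polyDist n (u ((i + q) % N)) (u ((i + q) % N + 1)) with hS
  have hsucc (m : ℕ) : S (m + 1) =
      S m + n * polyDist n (u ((i + m) % N)) (u ((i + m) % N + 1)) := by
    simp only [hS]
    rw [Finset.sum_range_succ]
    ring
  have hlift (m : ℕ) : u ((i + m) % N) = edgeParam n (S m) := by
    induction m with
    | zero => simpa [hS, Nat.mod_eq_of_lt (show i < N by omega)] using ha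
    | succ m ih =>
      obtain ⟨b, hb⟩ := (mem_polygon_iff (by omega)).1
        (hmem ((i + m) % N + 1) (by have := hmod m; omega))
      rw [hnext, hsucc, ih, hb, polyDist_edgeParam hn, Int.fract, mul_sub,
        mul_div_cancel₀ _ hn0.ne', ← edgeParam_add_mul (by omega) b (-⌊(b - S m) / n⌋)]
      congr 1
      push_cast
      ring
  refine ⟨S, by simp [hS], ?_, fun m => ?_⟩
  · simp only [hS]
    rw [sum_range_add_mod (fun j => polyDist n (u j) (u (j + 1))), hsum]
  · have hle : S m ≤ S (m + 1) := by
      rw [hsucc]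
      exact le_add_of_nonneg_right (mul_nonneg hn0.le (Int.fract_nonneg _))
    have hlt : S (m + 1) < S m + n := by
      rw [hsucc]
      have : polyDist n (u ((i + m) % N)) (u ((i + m) % N + 1)) < 1 := Int.fract_lt_one _
      nlinarith
    have hd := hdist _ (hmod m)
    have hb := hbtw _ (hmod m)
    rw [← hnext, hlift, hlift] at hd hb
    have hb' (x : ℝ) (h1 : S m < x) (h2 : x < S (m + 1)) :
        dist (edgeParam n (S m)) (edgeParam n x) < r := by
      refine hb _ ((mem_polygon_iff (by omega)).2 ⟨x, rfl⟩) ?_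
      rw [SCCWBtw, polyDist_edgeParam_of_lt hn h1.le (by linarith),
        polyDist_edgeParam_of_lt hn hle hlt]
      exact ⟨div_pos (by linarith) hn0, div_lt_div_of_pos_right (by linarith) hn0⟩
    refine ⟨hle, ?_, hd, hb'⟩
    by_contra! hhalf
    have := hb' _ (by linarith) hhalf
    linarith [rpoly_le_dist_half hn (S m)]

lemma IsStar.le_of_edgeParam {n l : ℕ} (hn : 3 ≤ n) {r r' : ℝ} (hrn : r ≤ rpoly n)
    (hrn' : r' ≤ rpoly n) {p p' : ℂ} {u u' : ℕ → ℂ} (h : IsStar n l r p u)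
    (h' : IsStar n l r' p' u') {i i' : ℕ} (hi : i ≤ 2 * l) (hi' : i' ≤ 2 * l) {a : ℝ} {k : ℤ}
    (ha : u i = edgeParam n a) (ha' : u' i' = edgeParam n (a + k)) : r' ≤ r := by
  by_contra! hr
  obtain ⟨S, hS0, hSN, hS⟩ := h.exists_lift hn hrn hi ha
  obtain ⟨S', hS0', hSN', hS'⟩ := h'.exists_lift hn hrn' hi' ha'
  have hlt (m : ℕ) (hle : S m + k ≤ S' m) : S (m + 1) + k < S' (m + 1) :=
    ((hS m).add_int k).lt_of_lt hn (hS' m) hr hrn' hle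
  have hle (m : ℕ) : S m + k ≤ S' m := by
    induction m with
    | zero => rw [hS0, hS0']
    | succ m ih => exact (hlt m ih).le
  have := hlt (2 * l) (hle _)
  rw [hSN, hSN'] at this
  linarith

lemma IsStar.eq_of_edgeParam {n l : ℕ} (hn : 3 ≤ n) {r r' : ℝ} (hrn : r ≤ rpoly n)
    (hrn' : r' ≤ rpoly n) {p p' : ℂ} {u u' : ℕ → ℂ} (h : IsStar n l r p u)
    (h' : IsStar n l r' p' u') {i i' : ℕ} (hi : i ≤ 2 * l) (hi' : i' ≤ 2 * l) {a : ℝ} {k : ℤ}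
    (ha : u i = edgeParam n a) (ha' : u' i' = edgeParam n (a + k)) : r = r' := by
  refine le_antisymm (h'.le_of_edgeParam hn hrn' hrn h hi' hi ha' (k := -k) ?_)
    (h.le_of_edgeParam hn hrn hrn' h' hi hi' ha ha')
  rw [ha]
  congr 1
  push_cast
  ring

lemma IsVertex.exists_edgeParam {n : ℕ} {x : ℂ} (h : IsVertex n x) :
    ∃ j : ℤ, x = edgeParam n j := by
  obtain ⟨j, -, rfl⟩ := h
  refine ⟨j, ?_⟩
  rw [edgeParam, Int.fract_intCast, Int.floor_intCast, ← zpow_natCast, nroot_zpow]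
  simp

lemma IsMidpoint.exists_edgeParam {n : ℕ} {x : ℂ} (h : IsMidpoint n x) :
    ∃ j : ℤ, x = edgeParam n (j + 1 / 2) := by
  obtain ⟨j, -, rfl⟩ := h
  refine ⟨j, ?_⟩
  rw [edgeParam_of_mem_Icc n (k := j) (by linarith) (by linarith), ← zpow_natCast,
    ← zpow_natCast, nroot_zpow, nroot_zpow]
  push_cast
  rw [mul_add, mul_one]
  ring

/-- All inscribed equilateral `(2l+1)`-pointed stars in `P_n` (side lengths in `(0, r_n]`)
containing a vertex of `P_n` among their points have the same side length; likewise all such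
stars containing a midpoint of an edge of `P_n` have the same side length. -/
theorem crossing_stars_same_side_length (l n : ℕ) (hl : 1 ≤ l) (hn : 4 * l + 2 ≤ n)
    (r r' : ℝ) (hr0 : 0 < r) (hrn : r ≤ rpoly n) (hr0' : 0 < r') (hrn' : r' ≤ rpoly n)
    (p p' : ℂ) (u u' : ℕ → ℂ) (hs : IsStar n l r p u) (hs' : IsStar n l r' p' u') :
    (((∃ i ≤ 2 * l, IsVertex n (u i)) ∧ (∃ j ≤ 2 * l, IsVertex n (u' j))) → r = r') ∧
    (((∃ i ≤ 2 * l, IsMidpoint n (u i)) ∧ (∃ j ≤ 2 * l, IsMidpoint n (u' j))) → r = r') := by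
  have hn3 : 3 ≤ n := by omega
  constructor
  · rintro ⟨⟨i, hi, hv⟩, j, hj, hv'⟩
    obtain ⟨a, ha⟩ := hv.exists_edgeParam
    obtain ⟨b, hb⟩ := hv'.exists_edgeParam
    refine hs.eq_of_edgeParam hn3 hrn hrn' hs' hi hj ha (k := b - a) ?_
    rw [hb]
    congr 1
    push_cast
    ring
  · rintro ⟨⟨i, hi, hv⟩, j, hj, hv'⟩
    obtain ⟨a, ha⟩ := hv.exists_edgeParam
    obtain ⟨b, hb⟩ := hv'.exists_edgeParam
    refine hs.eq_of_edgeParam hn3 hrn hrn' hs' hi hj ha (k := b - a) ?_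
    rw [hb]
    congr 1
    push_cast
    ring
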